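/- arXiv:2112.05791 — 6 statements merged into one kernel-verified Lean document; each statement's English description precedes it below -/
import Mathlib

section
/- Let ι be a countable type, t₀ > 0 a real number, and T : ι → ℝ a function with T i ≥ t₀ for all i. Assume there are constants C₀, C₁ > 0 such that for every natural number n the set {i : ι | T i ≤ n} is finite with cardinality at most C₀·exp(C₁·n). Let a : ι → ℂ satisfy ‖a i‖ ≤ C₂·(T i)·exp(C₃·T i) for all i, for some constants C₂ ≥ 0 and C₃ ≥ 0. Then the function λ ↦ Σ'_{i} a i · exp(−λ·T i) is complex differentiable (holomorphic) on the open half-plane {λ ∈ ℂ | Re λ > C₁ + C₃}. -/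
lemma summable_exp_orbits {ι : Type*} (T : ι → ℝ) (hT : ∀ i, 0 ≤ T i) (C₀ C₁ : ℝ)
    (hfin : ∀ n : ℕ, {i : ι | T i ≤ (n : ℝ)}.Finite)
    (hcard : ∀ n : ℕ, ((hfin n).toFinset.card : ℝ) ≤ C₀ * Real.exp (C₁ * n))
    (d : ℝ) (hd : 0 < d) (hs : 0 ≤ C₁ + d) :
    Summable (fun i => Real.exp (-(C₁ + d) * T i)) := by
  classical
  have hgeo : Summable (fun n : ℕ => C₀ * Real.exp (n * (-d))) :=
    (Real.summable_exp_nat_mul_iff.mpr (by linarith)).mul_left C₀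
  have hnn : ∀ n : ℕ, 0 ≤ C₀ * Real.exp (n * (-d)) := by
    intro n
    have h1 : 0 ≤ C₀ * Real.exp (C₁ * n) := le_trans (Nat.cast_nonneg _) (hcard n)
    have h2 : 0 ≤ C₀ := nonneg_of_mul_nonneg_left h1 (Real.exp_pos _)
    positivity
  have key : Summable (fun i => Real.exp (-(C₁ + d) * (⌈T i⌉₊ : ℝ))) := by
    refine summable_of_sum_le (c := ∑' n : ℕ, C₀ * Real.exp (n * (-d)))
      (fun i => (Real.exp_pos _).le) (fun u => ?_)
    rw [Finset.sum_comp (fun n : ℕ => Real.exp (-(C₁ + d) * (n : ℝ))) (fun i => ⌈T i⌉₊)]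
    refine le_trans (Finset.sum_le_sum (fun n _ => ?_))
      (hgeo.sum_le_tsum (u.image fun i => ⌈T i⌉₊) (fun n _ => hnn n))
    have hc : ((u.filter fun i => ⌈T i⌉₊ = n).card : ℝ) ≤ C₀ * Real.exp (C₁ * n) := by
      refine le_trans ?_ (hcard n)
      exact_mod_cast Finset.card_le_card (fun i hi => by
        simp only [Finset.mem_filter] at hi
        simp only [Set.Finite.mem_toFinset, Set.mem_setOf_eq]
        rw [← hi.2]
        exact Nat.le_ceil _)
    rw [nsmul_eq_mul]
    calc _ ≤ C₀ * Real.exp (C₁ * n) * Real.exp (-(C₁ + d) * (n : ℝ)) := by gcongr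
      _ = C₀ * Real.exp (n * (-d)) := by
        rw [mul_assoc, ← Real.exp_add]; congr 2; ring
  refine Summable.of_nonneg_of_le (fun i => (Real.exp_pos _).le) (fun i => ?_)
    (key.mul_left (Real.exp (C₁ + d)))
  rw [← Real.exp_add]
  apply Real.exp_le_exp.mpr
  have := (Nat.ceil_lt_add_one (hT i)).le
  nlinarith

/-- The weighted zeta function is holomorphic on the right half-plane
`Re λ > C₁ + C₃`, for an abstract family of closed orbits. -/
theorem weighted_zeta_differentiableOn
    {ι : Type*} [Countable ι] (t₀ : ℝ) (ht₀ : 0 < t₀)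
    (T : ι → ℝ) (hT : ∀ i, t₀ ≤ T i)
    (C₀ C₁ : ℝ) (hC₀ : 0 < C₀) (hC₁ : 0 < C₁)
    (hfin : ∀ n : ℕ, {i : ι | T i ≤ (n : ℝ)}.Finite)
    (hcard : ∀ n : ℕ, ((hfin n).toFinset.card : ℝ) ≤ C₀ * Real.exp (C₁ * n))
    (a : ι → ℂ) (C₂ C₃ : ℝ) (hC₂ : 0 ≤ C₂) (hC₃ : 0 ≤ C₃)
    (ha : ∀ i, ‖a i‖ ≤ C₂ * T i * Real.exp (C₃ * T i)) :
    DifferentiableOn ℂ (fun lam : ℂ => ∑' i : ι, a i * Complex.exp (-lam * (T i : ℂ)))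
      {lam : ℂ | C₁ + C₃ < lam.re} := by
  intro z hz
  simp only [Set.mem_setOf_eq] at hz
  obtain ⟨d, hd, hzd⟩ : ∃ d : ℝ, 0 < d ∧ C₁ + C₃ + 2 * d < z.re :=
    ⟨(z.re - (C₁ + C₃)) / 3, by linarith, by linarith⟩
  have hT0 : ∀ i, 0 ≤ T i := fun i => ht₀.le.trans (hT i)
  have hopen : IsOpen {w : ℂ | C₁ + C₃ + 2 * d < w.re} :=
    isOpen_lt continuous_const Complex.continuous_re
  have hsum := (summable_exp_orbits T hT0 C₀ C₁ hfin hcard d hd (by linarith)).mul_left (C₂ / d)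
  have hdiff := Complex.differentiableOn_tsum_of_summable_norm
    (F := fun i (w : ℂ) => a i * Complex.exp (-w * (T i : ℂ))) hsum
    (fun i => by fun_prop) hopen (fun i w hw => by
      simp only [Set.mem_setOf_eq] at hw
      have hre : (-w * (T i : ℂ)).re = -w.re * T i := by simp
      rw [norm_mul, Complex.norm_exp, hre]
      have h1 : T i ≤ Real.exp (d * T i) / d := by
        rw [le_div_iff₀ hd]
        linarith [Real.add_one_le_exp (d * T i)]
      have h2 : Real.exp (-w.re * T i) ≤ Real.exp (-(C₁ + C₃ + 2 * d) * T i) := by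
        apply Real.exp_le_exp.mpr
        nlinarith [hT0 i]
      calc ‖a i‖ * Real.exp (-w.re * T i)
          ≤ (C₂ * (Real.exp (d * T i) / d) * Real.exp (C₃ * T i))
              * Real.exp (-(C₁ + C₃ + 2 * d) * T i) := by
            refine mul_le_mul ((ha i).trans ?_) h2 (Real.exp_pos _).le (by positivity)
            gcongr
        _ = C₂ / d * (Real.exp (d * T i) * Real.exp (C₃ * T i)
              * Real.exp (-(C₁ + C₃ + 2 * d) * T i)) := by ring
        _ = C₂ / d * Real.exp (-(C₁ + d) * T i) := by
            rw [← Real.exp_add, ← Real.exp_add]; congr 2; ring)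
  exact (hdiff.differentiableAt (hopen.mem_nhds hzd)).differentiableWithinAt
end

section
/- Let V be a finite-dimensional real normed vector space and A : V → V a linear automorphism satisfying hyperbolic estimates with constants C₀ ≥ 1 and C₁ > 0 with respect to an A-invariant splitting V = E_s ⊕ E_u. Then the linear map id_V − A is bijective; in particular 1 is not an eigenvalue of A. -/
/-- For a hyperbolic linear automorphism `A` of a finite-dimensional real
normed space with invariant splitting `V = E_s ⊕ E_u`, the map `id - A` is bijective;
in particular `1` is not an eigenvalue of `A`. -/
theorem id_sub_hyperbolic_bijective
    {V : Type*} [NormedAddCommGroup V] [NormedSpace ℝ V] [FiniteDimensional ℝ V]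
    (A : V ≃ₗ[ℝ] V) (Es Eu : Submodule ℝ V) (hcompl : IsCompl Es Eu)
    (hAs : Submodule.map A.toLinearMap Es = Es)
    (hAu : Submodule.map A.toLinearMap Eu = Eu)
    (C₀ C₁ : ℝ) (hC₀ : 1 ≤ C₀) (hC₁ : 0 < C₁)
    (hs : ∀ v ∈ Es, ∀ n : ℕ, ‖(A.toLinearMap ^ n) v‖ ≤ C₀ * Real.exp (-C₁ * n) * ‖v‖)
    (hu : ∀ v ∈ Eu, ∀ n : ℕ, C₀⁻¹ * Real.exp (C₁ * n) * ‖v‖ ≤ ‖(A.toLinearMap ^ n) v‖) :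
    Function.Bijective (LinearMap.id (R := ℝ) (M := V) - A.toLinearMap) ∧
      ¬ Module.End.HasEigenvalue A.toLinearMap 1 := by
  have fix : ∀ v : V, A v = v → ∀ n : ℕ, (A.toLinearMap ^ n) v = v := by
    intro v hv n
    induction n with
    | zero => simp
    | succ k ih =>
      rw [pow_succ, Module.End.mul_apply]
      have h1 : A.toLinearMap v = v := hv
      rw [h1, ih]
  have hC : 0 < C₀ := by linarith
  obtain ⟨n, hn⟩ := exists_nat_gt (C₀ / C₁)
  have hlt : C₀ < Real.exp (C₁ * n) := by
    have h1 : C₀ < n * C₁ := (div_lt_iff₀ hC₁).mp hn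
    have h2 := Real.add_one_le_exp (C₁ * n)
    linarith
  have key : ∀ v : V, A v = v → v = 0 := by
    intro v hv
    have hmem : v ∈ Es ⊔ Eu := by rw [hcompl.sup_eq_top]; trivial
    obtain ⟨s, hsE, u, huE, rfl⟩ := Submodule.mem_sup.mp hmem
    have hAsE : A s ∈ Es := by
      rw [← hAs]; exact Submodule.mem_map_of_mem (f := A.toLinearMap) hsE
    have hAuE : A u ∈ Eu := by
      rw [← hAu]; exact Submodule.mem_map_of_mem (f := A.toLinearMap) huE
    rw [map_add] at hv
    have heq : A s - s = u - A u := by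
      rw [sub_eq_sub_iff_add_eq_add, hv, add_comm]
    have h0 : A s - s = 0 := by
      refine Submodule.disjoint_def.mp hcompl.disjoint _ (Es.sub_mem hAsE hsE) ?_
      rw [heq]; exact Eu.sub_mem huE hAuE
    have hs1 : A s = s := sub_eq_zero.mp h0
    have hu1 : A u = u := (sub_eq_zero.mp (heq.symm.trans h0)).symm
    have es := hs s hsE n
    have eu := hu u huE n
    rw [fix s hs1 n] at es
    rw [fix u hu1 n] at eu
    have c1 : C₀ * Real.exp (-C₁ * n) < 1 := by
      rw [neg_mul, Real.exp_neg, ← div_eq_mul_inv, div_lt_one (Real.exp_pos _)]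
      exact hlt
    have c2 : 1 < C₀⁻¹ * Real.exp (C₁ * n) := by
      rw [mul_comm, ← div_eq_mul_inv, one_lt_div hC]
      exact hlt
    have s0 : s = 0 := by
      by_contra h
      have := norm_pos_iff.mpr h
      nlinarith
    have u0 : u = 0 := by
      by_contra h
      have := norm_pos_iff.mpr h
      nlinarith
    rw [s0, u0, add_zero]
  have inj : Function.Injective (LinearMap.id (R := ℝ) (M := V) - A.toLinearMap) := by
    rw [injective_iff_map_eq_zero]
    intro v hv
    apply key
    have h1 : v - A v = 0 := hv
    exact (sub_eq_zero.mp h1).symm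
  refine ⟨⟨inj, LinearMap.injective_iff_surjective.mp inj⟩, ?_⟩
  intro h
  obtain ⟨v, hv⟩ := h.exists_hasEigenvector
  apply hv.2
  apply key
  have h1 := hv.apply_eq_smul
  rw [one_smul] at h1
  exact h1
end

section
/- Let V be a finite-dimensional real normed vector space, A : V → V a linear automorphism, and v₀ ∈ V with A v₀ = v₀. Let E_s and E_u be subspaces such that V is the internal direct sum of the span of v₀, E_s, and E_u, and such that A satisfies hyperbolic estimates with constants C₀ ≥ 1 and C₁ > 0 with respect to the A-invariant splitting of E_s ⊕ E_u into E_s and E_u. If ξ : V → ℝ is a linear functional with ξ(v₀) = 0 and ξ(A v) = ξ(v) for all v ∈ V, then ξ = 0. -/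
theorem vanish_on_invariant
    {V : Type*} [NormedAddCommGroup V] [NormedSpace ℝ V] [FiniteDimensional ℝ V]
    (A : V →ₗ[ℝ] V) (E : Submodule ℝ V) (hA : Submodule.map A E = E)
    (hfix : ∀ w ∈ E, A w = w → w = 0)
    (ξ : V →ₗ[ℝ] ℝ) (hξA : ∀ v : V, ξ (A v) = ξ v) :
    ∀ v ∈ E, ξ v = 0 := by
  have hm : ∀ x ∈ E, (A - LinearMap.id : V →ₗ[ℝ] V) x ∈ E := by
    intro x hx
    have h1 : A x ∈ E := by
      have := Submodule.mem_map_of_mem (f := A) hx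
      rwa [hA] at this
    simpa using E.sub_mem h1 hx
  let B : E →ₗ[ℝ] E := (A - LinearMap.id : V →ₗ[ℝ] V).restrict hm
  have hinj : Function.Injective B := by
    rw [← LinearMap.ker_eq_bot, LinearMap.ker_eq_bot']
    intro w hw
    have h2 : A w - w = 0 := by
      have := congrArg Subtype.val hw
      simpa [B] using this
    exact Subtype.ext (hfix w w.2 (sub_eq_zero.mp h2))
  have hsurj : Function.Surjective B := LinearMap.injective_iff_surjective.mp hinj
  intro v hv
  obtain ⟨w, hw⟩ := hsurj ⟨v, hv⟩
  have h3 : A w - w = v := by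
    have := congrArg Subtype.val hw
    simpa [B] using this
  rw [← h3, map_sub, hξA, sub_self]

/-- A linear functional annihilating the flow direction and invariant under
a hyperbolic linear automorphism must vanish. -/
theorem invariant_functional_vanishes
    {V : Type*} [NormedAddCommGroup V] [NormedSpace ℝ V] [FiniteDimensional ℝ V]
    (A : V ≃ₗ[ℝ] V) (v₀ : V) (hv₀ : A v₀ = v₀)
    (Es Eu : Submodule ℝ V)
    (hsplit : DirectSum.IsInternal ![Submodule.span ℝ {v₀}, Es, Eu])
    (hAs : Submodule.map A.toLinearMap Es = Es)
    (hAu : Submodule.map A.toLinearMap Eu = Eu)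
    (C₀ C₁ : ℝ) (hC₀ : 1 ≤ C₀) (hC₁ : 0 < C₁)
    (hs : ∀ v ∈ Es, ∀ n : ℕ, ‖(A.toLinearMap ^ n) v‖ ≤ C₀ * Real.exp (-C₁ * n) * ‖v‖)
    (hu : ∀ v ∈ Eu, ∀ n : ℕ, C₀⁻¹ * Real.exp (C₁ * n) * ‖v‖ ≤ ‖(A.toLinearMap ^ n) v‖)
    (ξ : V →ₗ[ℝ] ℝ) (hξ₀ : ξ v₀ = 0) (hξA : ∀ v : V, ξ (A v) = ξ v) :
    ξ = 0 := by
  have hpow : ∀ w, A w = w → ∀ n : ℕ, (A.toLinearMap ^ n) w = w := by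
    intro w hw n
    induction n with
    | zero => simp
    | succ k ih => rw [pow_succ, Module.End.mul_apply]; simpa [hw] using ih
  obtain ⟨n, hn⟩ : ∃ n : ℕ, C₀ < Real.exp (C₁ * n) := by
    obtain ⟨n, hn⟩ := exists_nat_gt (C₀ / C₁)
    refine ⟨n, ?_⟩
    rw [div_lt_iff₀ hC₁] at hn
    have := Real.add_one_le_exp (C₁ * n)
    linarith
  have hC : 0 < C₀ := by linarith
  have hS : ∀ v ∈ Es, ξ v = 0 := by
    refine vanish_on_invariant A.toLinearMap Es hAs ?_ ξ hξA
    intro w hw hf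
    have h := hs w hw n
    rw [hpow w hf n, neg_mul, Real.exp_neg, ← div_eq_mul_inv] at h
    have h1 : C₀ / Real.exp (C₁ * n) < 1 := (div_lt_one (Real.exp_pos _)).mpr hn
    by_contra h0
    have := norm_pos_iff.mpr h0
    nlinarith
  have hU : ∀ v ∈ Eu, ξ v = 0 := by
    refine vanish_on_invariant A.toLinearMap Eu hAu ?_ ξ hξA
    intro w hw hf
    have h := hu w hw n
    rw [hpow w hf n, inv_mul_eq_div] at h
    have h1 : 1 < Real.exp (C₁ * n) / C₀ := (one_lt_div hC).mpr hn
    by_contra h0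
    have := norm_pos_iff.mpr h0
    nlinarith
  have htop := hsplit.submodule_iSup_eq_top
  have hle : (⨆ i, ![Submodule.span ℝ {v₀}, Es, Eu] i) ≤ LinearMap.ker ξ := by
    refine iSup_le fun i => ?_
    fin_cases i
    · simpa [Submodule.span_le] using hξ₀
    · exact fun v hv => hS v hv
    · exact fun v hv => hU v hv
  rw [htop, top_le_iff] at hle
  exact LinearMap.ker_eq_top.mp hle
end

section
/- Let V be a finite-dimensional real normed vector space and A : V → V a linear automorphism satisfying hyperbolic estimates with constants C₀ ≥ 1 and C₁ > 0 with respect to an A-invariant splitting V = E_s ⊕ E_u. Then |det(id_V − A)| ≥ (1 − exp(−C₁))^{dim E_s} · (exp(C₁) − 1)^{dim E_u}; in particular det(id_V − A) ≠ 0, and the lower bound depends only on C₁ and the dimensions of E_s and E_u. -/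
/-- If the powers of `r` are dominated by a constant multiple of the powers of `s`, then `r ≤ s`. -/
theorem hyp_le_of_pow_le (r s K : ℝ) (hr : 0 ≤ r) (hs : 0 ≤ s)
    (h : ∀ n : ℕ, r ^ n ≤ K * s ^ n) : r ≤ s := by
  by_contra! hlt
  rcases hs.eq_or_lt with rfl | hs'
  · have := h 1
    simp at this
    linarith
  · have h1 : 1 < r / s := (one_lt_div hs').2 hlt
    obtain ⟨n, hn⟩ := pow_unbounded_of_one_lt K h1
    rw [div_pow, lt_div_iff₀ (by positivity)] at hn
    linarith [h n]

/-- A complex root of the characteristic polynomial gives a real invariant pair. -/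
theorem hyp_exists_pair {W : Type*} [AddCommGroup W] [Module ℝ W]
    {ι : Type*} [Fintype ι] [DecidableEq ι] (b : Module.Basis ι ℝ W) (B : W →ₗ[ℝ] W) (l : ℂ)
    (hl : ((LinearMap.toMatrix b b B).map (algebraMap ℝ ℂ)).charpoly.eval l = 0) :
    ∃ x y : W, (x ≠ 0 ∨ y ≠ 0) ∧ B x = l.re • x - l.im • y ∧ B y = l.im • x + l.re • y := by
  rw [Matrix.eval_charpoly, ← Matrix.exists_mulVec_eq_zero_iff] at hl
  obtain ⟨z, hz, hMz⟩ := hl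
  rw [Matrix.sub_mulVec, sub_eq_zero] at hMz
  have key : ∀ i, l * z i = ∑ j, (((LinearMap.toMatrix b b B) i j : ℝ) : ℂ) * z j := by
    intro i
    have := congrFun hMz i
    simpa [Matrix.scalar_apply, Matrix.mulVec_diagonal, Matrix.mulVec, dotProduct,
      Matrix.diagonal_apply] using this
  refine ⟨b.equivFun.symm (fun i => (z i).re), b.equivFun.symm (fun i => (z i).im), ?_, ?_, ?_⟩
  · by_contra! h
    apply hz
    obtain ⟨h1, h2⟩ := h
    rw [LinearEquiv.map_eq_zero_iff] at h1 h2
    ext i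
    exact Complex.ext (congrFun h1 i) (congrFun h2 i)
  · apply b.equivFun.injective
    ext i
    have h1 := congrFun (LinearMap.toMatrix_mulVec_repr b b B
      (b.equivFun.symm (fun i => (z i).re))) i
    have h2 := congrArg Complex.re (key i)
    simp [Matrix.mulVec, dotProduct, ← Module.Basis.equivFun_apply, -Module.Basis.equivFun_symm_apply] at h1 h2 ⊢
    rw [← h1, ← h2]
  · apply b.equivFun.injective
    ext i
    have h1 := congrFun (LinearMap.toMatrix_mulVec_repr b b B
      (b.equivFun.symm (fun i => (z i).im))) i
    have h2 := congrArg Complex.im (key i)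
    simp [Matrix.mulVec, dotProduct, ← Module.Basis.equivFun_apply, -Module.Basis.equivFun_symm_apply] at h1 h2 ⊢
    rw [← h1, ← h2]
    ring

theorem hyp_pow_pair {W : Type*} [AddCommGroup W] [Module ℝ W] (B : W →ₗ[ℝ] W) (l : ℂ) (x y : W)
    (hx : B x = l.re • x - l.im • y) (hy : B y = l.im • x + l.re • y) (n : ℕ) :
    (B ^ n) x = (l ^ n).re • x - (l ^ n).im • y ∧ (B ^ n) y = (l ^ n).im • x + (l ^ n).re • y := by
  induction n with
  | zero => simp
  | succ n ih =>
    obtain ⟨h1, h2⟩ := ih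
    rw [pow_succ', Module.End.mul_apply, Module.End.mul_apply, h1, h2, pow_succ]
    simp only [map_sub, map_add, map_smul, hx, hy, Complex.mul_re, Complex.mul_im]
    constructor <;> module

theorem hyp_norm_upper {W : Type*} [NormedAddCommGroup W] [NormedSpace ℝ W] (m : ℂ) (x y : W) :
    ‖m.re • x - m.im • y‖ + ‖m.im • x + m.re • y‖ ≤ 2 * ‖m‖ * (‖x‖ + ‖y‖) := by
  have h1 := norm_sub_le (m.re • x) (m.im • y)
  have h2 := norm_add_le (m.im • x) (m.re • y)
  simp only [norm_smul, Real.norm_eq_abs] at h1 h2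
  have h3 := mul_le_mul_of_nonneg_right (Complex.abs_re_le_norm m) (norm_nonneg x)
  have h4 := mul_le_mul_of_nonneg_right (Complex.abs_re_le_norm m) (norm_nonneg y)
  have h5 := mul_le_mul_of_nonneg_right (Complex.abs_im_le_norm m) (norm_nonneg x)
  have h6 := mul_le_mul_of_nonneg_right (Complex.abs_im_le_norm m) (norm_nonneg y)
  linarith

theorem hyp_norm_lower {W : Type*} [NormedAddCommGroup W] [NormedSpace ℝ W] (m : ℂ) (x y : W) :
    ‖m‖ * (‖x‖ + ‖y‖) ≤ 2 * (‖m.re • x - m.im • y‖ + ‖m.im • x + m.re • y‖) := by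
  rcases eq_or_ne m 0 with rfl | hm
  · simp
  have hpos : 0 < ‖m‖ := norm_pos_iff.2 hm
  have hsq : ‖m‖ ^ 2 = m.re * m.re + m.im * m.im := by
    rw [← Complex.normSq_eq_norm_sq, Complex.normSq_apply]
  have h := hyp_norm_upper ((starRingEnd ℂ) m) (m.re • x - m.im • y) (m.im • x + m.re • y)
  simp only [Complex.conj_re, Complex.conj_im, RCLike.norm_conj] at h
  have e1 : m.re • (m.re • x - m.im • y) - (-m.im) • (m.im • x + m.re • y) = (‖m‖ ^ 2) • x := by
    rw [hsq]; module
  have e2 : (-m.im) • (m.re • x - m.im • y) + m.re • (m.im • x + m.re • y) = (‖m‖ ^ 2) • y := by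
    rw [hsq]; module
  rw [e1, e2, norm_smul, norm_smul, Real.norm_of_nonneg (by positivity)] at h
  refine le_of_mul_le_mul_left ?_ hpos
  nlinarith [h]

theorem hyp_multiset_bound (s : Multiset ℂ) (c : ℝ) (hc : 0 ≤ c) (h : ∀ a ∈ s, c ≤ ‖1 - a‖) :
    c ^ s.card ≤ ‖(s.map (1 - ·)).prod‖ := by
  induction s using Multiset.induction_on with
  | empty => simp
  | cons a s ih =>
    rw [Multiset.card_cons, Multiset.map_cons, Multiset.prod_cons, norm_mul, pow_succ']
    have := ih (fun x hx => h x (Multiset.mem_cons_of_mem hx))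
    have := h a (Multiset.mem_cons_self a s)
    gcongr

/-- If every complexified eigenvalue has distance at least `c` from `1`, then the determinant of
`1 - B` is at least `c ^ dim`. -/
theorem hyp_det_bound {W : Type*} [NormedAddCommGroup W] [NormedSpace ℝ W] [FiniteDimensional ℝ W]
    (B : W →ₗ[ℝ] W) (c : ℝ) (hc : 0 ≤ c)
    (h : ∀ (l : ℂ) (x y : W), 0 < ‖x‖ + ‖y‖ →
      (∀ n : ℕ, (B ^ n) x = (l ^ n).re • x - (l ^ n).im • y ∧
        (B ^ n) y = (l ^ n).im • x + (l ^ n).re • y) → c ≤ ‖1 - l‖) :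
    c ^ Module.finrank ℝ W ≤ |LinearMap.det (LinearMap.id - B)| := by
  let b := Module.finBasis ℝ W
  set M := LinearMap.toMatrix b b B with hM
  set N := M.map (algebraMap ℝ ℂ) with hN
  have hdet : ((LinearMap.det (LinearMap.id - B) : ℝ) : ℂ) = N.charpoly.eval 1 := by
    rw [hN, Matrix.charpoly_map, Polynomial.eval_map_algebraMap, ← map_one (algebraMap ℝ ℂ),
      Polynomial.aeval_algebraMap_apply, Polynomial.coe_aeval_eq_eval, Matrix.eval_charpoly,
      ← LinearMap.det_toMatrix b, map_sub, LinearMap.toMatrix_id, map_one]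
    rfl
  have hsp : N.charpoly.Splits := IsAlgClosed.splits _
  rw [hsp.eval_eq_prod_roots_of_monic (Matrix.charpoly_monic N)] at hdet
  have hcard : N.charpoly.roots.card = Module.finrank ℝ W := by
    rw [← hsp.natDegree_eq_card_roots, Matrix.charpoly_natDegree_eq_dim, Fintype.card_fin]
  have hnorm : |LinearMap.det (LinearMap.id - B)| = ‖(N.charpoly.roots.map (1 - ·)).prod‖ := by
    rw [← hdet, Complex.norm_real, Real.norm_eq_abs]
  rw [hnorm]
  refine le_of_eq_of_le (congrArg (fun k => c ^ k) hcard.symm) ?_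
  apply hyp_multiset_bound _ _ hc
  intro l hl
  obtain ⟨x, y, hxy, hx, hy⟩ := hyp_exists_pair b B l (Polynomial.isRoot_of_mem_roots hl)
  refine h l x y ?_ (fun n => hyp_pow_pair B l x y hx hy n)
  rcases hxy with h' | h'
  · have := norm_pos_iff.2 h'
    positivity
  · have := norm_pos_iff.2 h'
    positivity

theorem hyp_stable {W : Type*} [NormedAddCommGroup W] [NormedSpace ℝ W] [FiniteDimensional ℝ W]
    (B : W →ₗ[ℝ] W) (C₀ C₁ : ℝ) (hC₁ : 0 < C₁)
    (hs : ∀ v, ∀ n : ℕ, ‖(B ^ n) v‖ ≤ C₀ * Real.exp (-C₁ * n) * ‖v‖) :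
    (1 - Real.exp (-C₁)) ^ Module.finrank ℝ W ≤ |LinearMap.det (LinearMap.id - B)| := by
  have h1 : Real.exp (-C₁) ≤ 1 := Real.exp_le_one_iff.2 (by linarith)
  apply hyp_det_bound _ _ (by linarith)
  intro l x y hxy h
  have hl : ‖l‖ ≤ Real.exp (-C₁) := by
    apply hyp_le_of_pow_le _ _ (2 * C₀) (norm_nonneg _) (Real.exp_nonneg _)
    intro n
    have a1 := hs x n
    have a2 := hs y n
    have a3 := hyp_norm_lower (l ^ n) x y
    rw [(h n).1] at a1
    rw [(h n).2] at a2
    rw [mul_comm (-C₁), Real.exp_nat_mul] at a1 a2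
    rw [norm_pow] at a3
    refine le_of_mul_le_mul_right ?_ hxy
    linarith
  have := norm_sub_norm_le (1 : ℂ) l
  rw [norm_one] at this
  linarith

theorem hyp_unstable {W : Type*} [NormedAddCommGroup W] [NormedSpace ℝ W] [FiniteDimensional ℝ W]
    (B : W →ₗ[ℝ] W) (C₀ C₁ : ℝ) (hC₀ : 1 ≤ C₀) (hC₁ : 0 < C₁)
    (hu : ∀ v, ∀ n : ℕ, C₀⁻¹ * Real.exp (C₁ * n) * ‖v‖ ≤ ‖(B ^ n) v‖) :
    (Real.exp C₁ - 1) ^ Module.finrank ℝ W ≤ |LinearMap.det (LinearMap.id - B)| := by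
  have h1 : 1 ≤ Real.exp C₁ := Real.one_le_exp hC₁.le
  have hC : 0 < C₀ := by linarith
  apply hyp_det_bound _ _ (by linarith)
  intro l x y hxy h
  have hl : Real.exp C₁ ≤ ‖l‖ := by
    apply hyp_le_of_pow_le _ _ (C₀ * 2) (Real.exp_nonneg _) (norm_nonneg _)
    intro n
    have a1 := hu x n
    have a2 := hu y n
    have a3 := hyp_norm_upper (l ^ n) x y
    rw [(h n).1] at a1
    rw [(h n).2] at a2
    rw [mul_comm C₁, Real.exp_nat_mul] at a1 a2
    rw [norm_pow] at a3
    refine le_of_mul_le_mul_right ?_ hxy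
    have a4 : C₀⁻¹ * (Real.exp C₁ ^ n * (‖x‖ + ‖y‖)) ≤ 2 * ‖l‖ ^ n * (‖x‖ + ‖y‖) := by linarith
    rw [inv_mul_le_iff₀ hC] at a4
    linarith
  have := norm_sub_norm_le l (1 : ℂ)
  rw [norm_one, norm_sub_rev] at this
  linarith

theorem hyp_det_split {V : Type*} [AddCommGroup V] [Module ℝ V] [FiniteDimensional ℝ V]
    (A : V →ₗ[ℝ] V) (E F : Submodule ℝ V) (hc : IsCompl E F)
    (hE : ∀ v ∈ E, A v ∈ E) (hF : ∀ v ∈ F, A v ∈ F) :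
    LinearMap.det (LinearMap.id - A) = LinearMap.det (LinearMap.id - A.restrict hE) *
      LinearMap.det (LinearMap.id - A.restrict hF) := by
  rw [← LinearMap.det_prodMap, ← LinearMap.det_conj _ (Submodule.prodEquivOfIsCompl E F hc)]
  congr 1
  apply LinearMap.ext
  intro v
  obtain ⟨w, rfl⟩ := (Submodule.prodEquivOfIsCompl E F hc).surjective v
  simp only [LinearMap.comp_apply, LinearEquiv.coe_coe, LinearEquiv.symm_apply_apply]
  simp only [Submodule.coe_prodEquivOfIsCompl', LinearMap.prodMap_apply, LinearMap.sub_apply,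
    LinearMap.id_apply, Submodule.coe_sub, LinearMap.coe_restrict_apply, map_add]

/-- Uniform lower bound on `|det(id - A)|` for a hyperbolic linear
automorphism, depending only on `C₁` and the dimensions of the stable/unstable spaces. -/
theorem det_id_sub_hyperbolic_lower_bound
    {V : Type*} [NormedAddCommGroup V] [NormedSpace ℝ V] [FiniteDimensional ℝ V]
    (A : V ≃ₗ[ℝ] V) (Es Eu : Submodule ℝ V) (hcompl : IsCompl Es Eu)
    (hAs : Submodule.map A.toLinearMap Es = Es)
    (hAu : Submodule.map A.toLinearMap Eu = Eu)
    (C₀ C₁ : ℝ) (hC₀ : 1 ≤ C₀) (hC₁ : 0 < C₁)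
    (hs : ∀ v ∈ Es, ∀ n : ℕ, ‖(A.toLinearMap ^ n) v‖ ≤ C₀ * Real.exp (-C₁ * n) * ‖v‖)
    (hu : ∀ v ∈ Eu, ∀ n : ℕ, C₀⁻¹ * Real.exp (C₁ * n) * ‖v‖ ≤ ‖(A.toLinearMap ^ n) v‖) :
    (1 - Real.exp (-C₁)) ^ (Module.finrank ℝ Es) * (Real.exp C₁ - 1) ^ (Module.finrank ℝ Eu)
        ≤ |LinearMap.det (LinearMap.id (R := ℝ) (M := V) - A.toLinearMap)| ∧
      LinearMap.det (LinearMap.id (R := ℝ) (M := V) - A.toLinearMap) ≠ 0 := by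
  have hE : ∀ v ∈ Es, A.toLinearMap v ∈ Es := fun v hv => by
    have := Submodule.mem_map_of_mem (f := A.toLinearMap) hv
    rwa [hAs] at this
  have hF : ∀ v ∈ Eu, A.toLinearMap v ∈ Eu := fun v hv => by
    have := Submodule.mem_map_of_mem (f := A.toLinearMap) hv
    rwa [hAu] at this
  have h1 := hyp_stable (A.toLinearMap.restrict hE) C₀ C₁ hC₁ (fun v n => by
    have := hs v v.2 n
    rw [Module.End.pow_restrict n hE]
    exact this)
  have h2 := hyp_unstable (A.toLinearMap.restrict hF) C₀ C₁ hC₀ hC₁ (fun v n => by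
    have := hu v v.2 n
    rw [Module.End.pow_restrict n hF]
    exact this)
  have p1 : 0 < 1 - Real.exp (-C₁) := by
    have : Real.exp (-C₁) < 1 := Real.exp_lt_one_iff.2 (by linarith)
    linarith
  have p2 : 0 < Real.exp C₁ - 1 := by
    have : 1 < Real.exp C₁ := Real.one_lt_exp_iff.2 hC₁
    linarith
  have key : (1 - Real.exp (-C₁)) ^ (Module.finrank ℝ Es) *
      (Real.exp C₁ - 1) ^ (Module.finrank ℝ Eu)
        ≤ |LinearMap.det (LinearMap.id (R := ℝ) (M := V) - A.toLinearMap)| := by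
    rw [hyp_det_split A.toLinearMap Es Eu hcompl hE hF, abs_mul]
    gcongr
  refine ⟨key, abs_pos.1 (lt_of_lt_of_le ?_ key)⟩
  positivity
end

section
/- Let ι be a countable type, t₀ > 0 a real number, and T : ι → ℝ a function with T i ≥ t₀ for all i. Assume there are constants C₀, C₁ > 0 such that for every natural number n the set {i : ι | T i ≤ n} is finite with cardinality at most C₀·exp(C₁·n). Let w : ι → ℂ satisfy ‖w i‖ ≤ C₂·(T i)·exp(C₃·T i) for all i, for constants C₂ ≥ 0 and C₃ ≥ 0. Then for every λ ∈ ℂ with Re λ > C₁ + C₃, all of the following series converge absolutely and one has the identity: Σ'_{i} w i · exp(−λ·T i) / ((1 − exp(−T i)) · (exp(T i) − 1)) = Σ'_{n ≥ 1} Σ'_{i} w i · exp(−(λ + n)·T i) / (1 − exp(−T i)). -/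
theorem aux_summable_exp {ι : Type*} (T : ι → ℝ)
    (C₀ C₁ : ℝ)
    (hfin : ∀ n : ℕ, {i : ι | T i ≤ (n : ℝ)}.Finite)
    (hT : ∀ i, 0 ≤ T i)
    (hcard : ∀ n : ℕ, ((hfin n).toFinset.card : ℝ) ≤ C₀ * Real.exp (C₁ * n))
    (s : ℝ) (hs0 : 0 ≤ s) (hs : C₁ < s) : Summable (fun i => Real.exp (-s * T i)) := by
  classical
  let g : ℕ × ι → ℝ := fun p => if T p.2 ≤ (p.1 : ℝ) then Real.exp (-s * p.1) else 0
  have hg0 : 0 ≤ g := by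
    intro p
    simp only [g, Pi.zero_apply]
    split_ifs <;> positivity
  have hsum : ∀ n : ℕ, HasSum (fun i => g (n, i))
      (((hfin n).toFinset.card : ℝ) * Real.exp (-s * n)) := by
    intro n
    have h := hasSum_sum_of_ne_finset_zero (L := SummationFilter.unconditional ι) (f := fun i => g (n, i)) (s := (hfin n).toFinset)
      (by
        intro i hi
        have : ¬ T i ≤ (n : ℝ) := by simpa using hi
        simp [g, this])
    convert h using 1
    rw [Finset.sum_congr rfl (g := fun _ => Real.exp (-s * n))]
    · simp
    · intro i hi
      have : T i ≤ (n : ℝ) := by simpa using hi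
      simp [g, this]
  have hg : Summable g := by
    rw [summable_prod_of_nonneg hg0]
    refine ⟨fun n => (hsum n).summable, ?_⟩
    have hgeo : Summable (fun n : ℕ => C₀ * (Real.exp (C₁ - s)) ^ n) :=
      (summable_geometric_of_lt_one (Real.exp_pos _).le
        (by rw [Real.exp_lt_one_iff]; linarith)).mul_left _
    refine Summable.of_nonneg_of_le (fun n => tsum_nonneg fun i => hg0 _) (fun n => ?_) hgeo
    rw [(hsum n).tsum_eq]
    calc _ ≤ C₀ * Real.exp (C₁ * n) * Real.exp (-s * n) := by
          gcongr
          exact hcard n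
      _ = _ := by
          rw [← Real.exp_nat_mul, mul_assoc, ← Real.exp_add]
          ring_nf
  have h2 := hg.comp_injective (i := fun i => (⌈T i⌉₊, i)) (fun a b h => by simpa using (Prod.ext_iff.1 h).2)
  refine Summable.of_nonneg_of_le (fun i => (Real.exp_pos _).le) (fun i => ?_)
    (h2.mul_left (Real.exp s))
  have h3 : T i ≤ (⌈T i⌉₊ : ℝ) := Nat.le_ceil _
  have h4 : (⌈T i⌉₊ : ℝ) < T i + 1 := Nat.ceil_lt_add_one (hT i)
  simp only [g, Function.comp, h3, if_true]
  rw [← Real.exp_add]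
  apply Real.exp_le_exp.2
  nlinarith

/-- Abstract form of the relation `Z_f(λ) = Σ_{n≥1} 𝒵_f(λ+n)` between the
weighted zeta function and the Anantharaman–Zelditch zeta function, with all series
converging absolutely for `Re λ > C₁ + C₃`. -/
theorem weighted_zeta_eq_sum_AZ_zeta
    {ι : Type*} [Countable ι] (t₀ : ℝ) (ht₀ : 0 < t₀)
    (T : ι → ℝ) (hT : ∀ i, t₀ ≤ T i)
    (C₀ C₁ : ℝ) (hC₀ : 0 < C₀) (hC₁ : 0 < C₁)
    (hfin : ∀ n : ℕ, {i : ι | T i ≤ (n : ℝ)}.Finite)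
    (hcard : ∀ n : ℕ, ((hfin n).toFinset.card : ℝ) ≤ C₀ * Real.exp (C₁ * n))
    (w : ι → ℂ) (C₂ C₃ : ℝ) (hC₂ : 0 ≤ C₂) (hC₃ : 0 ≤ C₃)
    (hw : ∀ i, ‖w i‖ ≤ C₂ * T i * Real.exp (C₃ * T i))
    (lam : ℂ) (hlam : C₁ + C₃ < lam.re) :
    Summable (fun i : ι => ‖w i * Complex.exp (-lam * (T i : ℂ)) /
        (((1 - Real.exp (-(T i))) * (Real.exp (T i) - 1) : ℝ) : ℂ)‖) ∧
      (∀ n : ℕ, Summable (fun i : ι => ‖w i * Complex.exp (-(lam + (n + 1 : ℕ)) * (T i : ℂ)) /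
          ((1 - Real.exp (-(T i)) : ℝ) : ℂ)‖)) ∧
      Summable (fun n : ℕ => ‖∑' i : ι, w i * Complex.exp (-(lam + (n + 1 : ℕ)) * (T i : ℂ)) /
          ((1 - Real.exp (-(T i)) : ℝ) : ℂ)‖) ∧
      (∑' i : ι, w i * Complex.exp (-lam * (T i : ℂ)) /
          (((1 - Real.exp (-(T i))) * (Real.exp (T i) - 1) : ℝ) : ℂ))
        = ∑' n : ℕ, ∑' i : ι, w i * Complex.exp (-(lam + (n + 1 : ℕ)) * (T i : ℂ)) /
            ((1 - Real.exp (-(T i)) : ℝ) : ℂ) := by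
  have hTpos : ∀ i, 0 < T i := fun i => ht₀.trans_le (hT i)
  obtain ⟨s, hs1, hs2⟩ : ∃ s, C₁ < s ∧ s < lam.re - C₃ := exists_between (by linarith)
  have hS := aux_summable_exp T C₀ C₁ hfin (fun i => (hTpos i).le) hcard s (by linarith) hs1
  set d : ℝ := lam.re - C₃ - s with hd
  have hdpos : 0 < d := by rw [hd]; linarith
  set r : ℝ := Real.exp (-t₀) with hr
  have hr0 : 0 < r := Real.exp_pos _
  have hr1 : r < 1 := by rw [hr, Real.exp_lt_one_iff]; linarith
  let F : ℕ × ι → ℂ := fun p => w p.2 * Complex.exp (-(lam + (p.1 + 1 : ℕ)) * (T p.2 : ℂ)) /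
          ((1 - Real.exp (-(T p.2)) : ℝ) : ℂ)
  have hrT : ∀ i, Real.exp (-(T i)) ≤ r := fun i => Real.exp_le_exp.2 (by linarith [hT i])
  have hFb : ∀ p, ‖F p‖ ≤ r ^ p.1 * ((C₂ / d / (1 - r)) * Real.exp (-s * T p.2)) := by
    rintro ⟨n, i⟩
    have hrTi := hrT i
    have e0 : ‖F (n, i)‖ = ‖w i‖ * Real.exp (-(lam.re + (n + 1)) * T i) /
        (1 - Real.exp (-(T i))) := by
      simp only [F]
      rw [norm_div, norm_mul, Complex.norm_exp, Complex.norm_real, Real.norm_eq_abs,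
        abs_of_pos (by linarith)]
      congr 3
      simp
    have e1 : T i ≤ Real.exp (d * T i) / d := by
      rw [le_div_iff₀ hdpos]
      linarith [Real.add_one_le_exp (d * T i)]
    have e2 : Real.exp (-(T i)) ^ (n + 1) ≤ r ^ n := by
      calc _ ≤ r ^ (n + 1) := by gcongr
        _ ≤ r ^ n := pow_le_pow_of_le_one hr0.le hr1.le (by omega)
    have hpos : 0 < 1 - r := by linarith
    rw [e0]
    calc _ ≤ (C₂ * (Real.exp (d * T i) / d) * Real.exp (C₃ * T i)) *
            Real.exp (-(lam.re + (n + 1)) * T i) / (1 - r) := by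
          have := (hw i).trans (b := C₂ * T i * Real.exp (C₃ * T i))
            (c := C₂ * (Real.exp (d * T i) / d) * Real.exp (C₃ * T i)) (by gcongr)
          gcongr
      _ = Real.exp (-(T i)) ^ (n + 1) * ((C₂ / d / (1 - r)) * Real.exp (-s * T i)) := by
          have : Real.exp (-(T i)) ^ (n + 1) * Real.exp (-s * T i) = Real.exp (d * T i) *
              Real.exp (C₃ * T i) * Real.exp (-(lam.re + (n + 1)) * T i) := by
            rw [← Real.exp_nat_mul, ← Real.exp_add, ← Real.exp_add, ← Real.exp_add, hd]
            congr 1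
            push_cast
            ring
          linear_combination (-(C₂ / d / (1 - r))) * this
      _ ≤ _ := by gcongr
  have hFn : Summable (fun p => ‖F p‖) := by
    refine Summable.of_nonneg_of_le (fun p => norm_nonneg _) hFb ?_
    exact (summable_geometric_of_lt_one hr0.le hr1).mul_of_nonneg
      (hS.mul_left (C₂ / d / (1 - r))) (fun n => by positivity)
      (fun i => by
        have hpos : 0 < 1 - r := by linarith
        positivity)
  have hF : Summable F := hFn.of_norm
  have hG : ∀ i, ∑' n, F (n, i) = w i * Complex.exp (-lam * (T i : ℂ)) /
        (((1 - Real.exp (-(T i))) * (Real.exp (T i) - 1) : ℝ) : ℂ) := by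
    intro i
    have hlt : Real.exp (-(T i)) < 1 := (hrT i).trans_lt hr1
    have hq : ‖((Real.exp (-(T i)) : ℝ) : ℂ)‖ < 1 := by
      rw [Complex.norm_real, Real.norm_eq_abs, abs_of_pos (Real.exp_pos _)]
      exact hlt
    have h := (hasSum_geometric_of_norm_lt_one hq).mul_left
      (w i * Complex.exp (-lam * (T i : ℂ)) * ((Real.exp (-(T i)) : ℝ) : ℂ) /
        ((1 - Real.exp (-(T i)) : ℝ) : ℂ))
    have hfun : (fun n => F (n, i)) = fun n : ℕ => (w i * Complex.exp (-lam * (T i : ℂ)) *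
        ((Real.exp (-(T i)) : ℝ) : ℂ) / ((1 - Real.exp (-(T i)) : ℝ) : ℂ)) *
        ((Real.exp (-(T i)) : ℝ) : ℂ) ^ n := by
      funext n
      have : Complex.exp (-(lam + (n + 1 : ℕ)) * (T i : ℂ)) = Complex.exp (-lam * (T i : ℂ)) *
        ((Real.exp (-(T i)) : ℝ) : ℂ) * ((Real.exp (-(T i)) : ℝ) : ℂ) ^ n := by
        rw [Complex.ofReal_exp, ← Complex.exp_nat_mul, ← Complex.exp_add, ← Complex.exp_add]
        congr 1
        push_cast
        ring
      simp only [F]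
      rw [this]
      ring
    rw [hfun, h.tsum_eq]
    have hb : ((1 - Real.exp (-(T i)) : ℝ) : ℂ) ≠ 0 := by
      rw [Complex.ofReal_ne_zero]; linarith
    have hgt : 1 < Real.exp (T i) := Real.one_lt_exp_iff.2 (hTpos i)
    have hc : ((Real.exp (T i) - 1 : ℝ) : ℂ) ≠ 0 := by
      rw [Complex.ofReal_ne_zero]; linarith
    have hk : ((Real.exp (-(T i)) : ℝ) : ℂ) * ((Real.exp (T i) - 1 : ℝ) : ℂ) =
        ((1 - Real.exp (-(T i)) : ℝ) : ℂ) := by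
      rw [← Complex.ofReal_mul, mul_sub, ← Real.exp_add]
      simp
    have hb' : (1 : ℂ) - ((Real.exp (-(T i)) : ℝ) : ℂ) = ((1 - Real.exp (-(T i)) : ℝ) : ℂ) := by
      push_cast; ring
    rw [hb', Complex.ofReal_mul, ← div_eq_mul_inv, div_div, div_eq_div_iff (mul_ne_zero hb hb)
      (mul_ne_zero hb hc)]
    linear_combination (w i * Complex.exp (-lam * (T i : ℂ)) *
      ((1 - Real.exp (-(T i)) : ℝ) : ℂ)) * hk
  have hswap : Summable (fun p : ι × ℕ => ‖F p.swap‖) := hFn.comp_injective Prod.swap_injective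
  refine ⟨?_, fun n => hFn.prod_factor n, ?_, ?_⟩
  · refine Summable.of_nonneg_of_le (fun i => norm_nonneg _) (fun i => ?_) hswap.prod
    rw [← hG i]
    exact norm_tsum_le_tsum_norm (hswap.prod_factor i)
  · exact Summable.of_nonneg_of_le (fun n => norm_nonneg _)
      (fun n => norm_tsum_le_tsum_norm (hFn.prod_factor n)) hFn.prod
  · rw [← tsum_congr hG]
    exact Summable.tsum_comm (f := fun n i => F (n, i)) hF
end

section
/- Let M be a set and φ : ℝ → M → M a flow, i.e. φ 0 x = x and φ s (φ t x) = φ (s + t) x for all s, t ∈ ℝ and x ∈ M. Call a subset A ⊆ M flow-convex if for all x ∈ A and all t ≥ 0 with φ t x ∈ A one has φ s x ∈ A for every s with 0 ≤ s ≤ t. If A is flow-convex, then for every T ∈ ℝ the set B := {x ∈ M | φ (−T) x ∈ A ∧ x ∈ A ∧ φ T x ∈ A} is flow-convex. -/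
/-- A subset `A` is flow-convex for `φ` if whenever `x ∈ A` and `φ t x ∈ A` for some
`t ≥ 0`, the whole flow segment `φ s x`, `0 ≤ s ≤ t`, lies in `A`. -/
def FlowConvex {M : Type*} (φ : ℝ → M → M) (A : Set M) : Prop :=
  ∀ x ∈ A, ∀ t : ℝ, 0 ≤ t → φ t x ∈ A → ∀ s : ℝ, 0 ≤ s → s ≤ t → φ s x ∈ A

/-- If `A` is flow-convex then so is
`B = {x | φ (−T) x ∈ A ∧ x ∈ A ∧ φ T x ∈ A}`. -/
theorem flowConvex_inter_shifts
    {M : Type*} (φ : ℝ → M → M)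
    (hφ0 : ∀ x : M, φ 0 x = x)
    (hφadd : ∀ (s t : ℝ) (x : M), φ s (φ t x) = φ (s + t) x)
    (A : Set M) (hA : FlowConvex φ A) (T : ℝ) :
    FlowConvex φ {x : M | φ (-T) x ∈ A ∧ x ∈ A ∧ φ T x ∈ A} := by
  have comm : ∀ (a b : ℝ) (x : M), φ a (φ b x) = φ b (φ a x) := by
    intro a b x
    rw [hφadd, hφadd, add_comm]
  rintro x ⟨h1, h2, h3⟩ t ht ⟨k1, k2, k3⟩ s hs hst
  refine ⟨?_, hA x h2 t ht k2 s hs hst, ?_⟩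
  · rw [comm] at k1 ⊢
    exact hA _ h1 t ht k1 s hs hst
  · rw [comm] at k3 ⊢
    exact hA _ h3 t ht k3 s hs hst
end
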